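/- Let k, m, n be positive integers, r an integer, and γ ∈ Γ^J. Then, as functions on ℍ×ℂ, (L_m − (m(2k−1)/6)E₂)((q^nζ^r)|_{k,m}γ) = ((L_m − (m(2k−1)/6)E₂)(q^nζ^r))|_{k+2,m}γ, where L_m = 4mD_τ − D_z² is the heat operator. -/

import Mathlib

noncomputable section

open Complex MeasureTheory Set
open scoped ComplexConjugate

/-- `e w = exp (2 π i w)`. -/
def e (w : ℂ) : ℂ := Complex.exp (2 * (Real.pi : ℂ) * Complex.I * w)

/-- The monomial `q^n ζ^r`, i.e. `(τ, z) ↦ e^{2πi(nτ + rz)}`. -/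
def Qmon (n : ℕ) (r : ℤ) (τ z : ℂ) : ℂ := e ((n : ℂ) * τ + (r : ℂ) * z)

/-- `σ₁(n)`, the sum of the positive divisors of `n`. -/
def sigma1 (n : ℕ) : ℕ := ∑ d ∈ n.divisors, d

/-- The weight-2 Eisenstein series `E₂(τ) = 1 - 24 ∑_{n ≥ 1} σ₁(n) e^{2πinτ}`. -/
def E2 (τ : ℂ) : ℂ := 1 - 24 * ∑' n : ℕ, (sigma1 (n + 1) : ℂ) * e (((n : ℂ) + 1) * τ)

/-- The deformed Eisenstein series
`J₁(τ,z) = ζ/(ζ-1) - 1/2 - ∑_{a,b ≥ 1} (ζ^a - ζ^{-a}) q^{ab}`. -/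
def J1 (τ z : ℂ) : ℂ :=
  e z / (e z - 1) - 1 / 2 -
    ∑' p : ℕ × ℕ, (e (((p.1 : ℂ) + 1) * z) - e (-(((p.1 : ℂ) + 1) * z))) *
      e (((p.1 : ℂ) + 1) * ((p.2 : ℂ) + 1) * τ)

/-- The deformed Eisenstein series
`J₂(τ,z) = 1/6 - 2 ∑_{a,b ≥ 1} b (ζ^a + ζ^{-a}) q^{ab}`. -/
def J2 (τ z : ℂ) : ℂ :=
  1 / 6 - 2 * ∑' p : ℕ × ℕ, ((p.2 : ℂ) + 1) *
      (e (((p.1 : ℂ) + 1) * z) + e (-(((p.1 : ℂ) + 1) * z))) *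
      e (((p.1 : ℂ) + 1) * ((p.2 : ℂ) + 1) * τ)

/-- `D_τ = (1/2πi) ∂/∂τ`. -/
def Dt (φ : ℂ → ℂ → ℂ) : ℂ → ℂ → ℂ :=
  fun τ z => (1 / (2 * (Real.pi : ℂ) * Complex.I)) * deriv (fun t => φ t z) τ

/-- `D_z = (1/2πi) ∂/∂z`. -/
def Dz (φ : ℂ → ℂ → ℂ) : ℂ → ℂ → ℂ :=
  fun τ z => (1 / (2 * (Real.pi : ℂ) * Complex.I)) * deriv (fun w => φ τ w) z

/-- The slash action `φ ↦ φ|_{k,m} γ` for `γ = ((a,b;c,d),(λ,μ)) ∈ Γ^J`. -/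
def slash (k m : ℤ) (a b c d lam mu : ℤ) (φ : ℂ → ℂ → ℂ) (τ z : ℂ) : ℂ :=
  ((c : ℂ) * τ + (d : ℂ)) ^ (-k) *
    e ((m : ℂ) * (-(c : ℂ) * (z + (lam : ℂ) * τ + (mu : ℂ)) ^ 2 / ((c : ℂ) * τ + (d : ℂ)) +
        (lam : ℂ) ^ 2 * τ + 2 * (lam : ℂ) * z)) *
    φ (((a : ℂ) * τ + (b : ℂ)) / ((c : ℂ) * τ + (d : ℂ)))
      ((z + (lam : ℂ) * τ + (mu : ℂ)) / ((c : ℂ) * τ + (d : ℂ)))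

/-- The domain `D' = {(τ,z) : 0 < Im τ, |Im z| < Im τ, e^{2πiz} ≠ 1}`. -/
def D' : Set (ℂ × ℂ) := {p | 0 < p.1.im ∧ |p.2.im| < p.1.im ∧ e p.2 ≠ 1}

/-- The Oberdieck derivative `Oφ = D_τφ - (k/12)E₂φ - J₁D_zφ + mJ₂φ` of weight `k`, index `m`. -/
def Ober (k m : ℕ) (φ : ℂ → ℂ → ℂ) : ℂ → ℂ → ℂ :=
  fun τ z => Dt φ τ z - ((k : ℂ) / 12) * E2 τ * φ τ z - J1 τ z * Dz φ τ z +
    (m : ℂ) * J2 τ z * φ τ z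

/-- The heat operator `L_m = 4m D_τ - D_z²`. -/
def Heat (m : ℕ) (φ : ℂ → ℂ → ℂ) : ℂ → ℂ → ℂ :=
  fun τ z => 4 * (m : ℂ) * Dt φ τ z - Dz (Dz φ) τ z

/-- The modified heat operator `L_{k,m} = L_m - (m(2k-1)/6) E₂`. -/
def HeatE (k m : ℕ) (φ : ℂ → ℂ → ℂ) : ℂ → ℂ → ℂ :=
  fun τ z => Heat m φ τ z - (m : ℂ) * (2 * (k : ℂ) - 1) / 6 * E2 τ * φ τ z

/-- The Jacobi–Serre derivative of weight `k` and index `m`. -/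
def JSerre (k m : ℕ) (φ : ℂ → ℂ → ℂ) : ℂ → ℂ → ℂ :=
  fun τ z => Dt φ τ z - ((k : ℂ) / 12) * E2 τ * φ τ z +
    (1 / (1 - 4 * (m : ℂ))) *
      (Dz (Dz φ) τ z - J1 τ z * Dz φ τ z + (m : ℂ) * J2 τ z * φ τ z -
        ((m : ℂ) / 6) * E2 τ * φ τ z)

/-- The error function `erf a = (2/√π) ∫₀^a e^{-t²} dt`. -/
def erf (a : ℝ) : ℝ := 2 / Real.sqrt Real.pi * ∫ t in (0 : ℝ)..a, Real.exp (-t ^ 2)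

/-- Euler's integral for `₂F₁(1/2, k+1; 3/2; x)`:
`F_k(x) = (1/2) ∫₀¹ t^{-1/2} (1 - xt)^{-(k+1)} dt`. -/
def Fk (k x : ℝ) : ℝ := (1 / 2) * ∫ t in (0 : ℝ)..1, t ^ (-(1 : ℝ) / 2) * (1 - x * t) ^ (-(k + 1))

/-- The integration region `(u,v,x,y) ∈ [0,1] × (0,∞) × [0,1] × ℝ`. -/
def Reg : Set (ℝ × ℝ × ℝ × ℝ) := Icc 0 1 ×ˢ Ioi 0 ×ˢ Icc 0 1 ×ˢ univ

/-- The Fourier series `φ(τ,z) = ∑_{n,r} c(n,r) q^n ζ^r`. -/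
def phiF (c : ℕ → ℤ → ℂ) (τ z : ℂ) : ℂ :=
  ∑' p : ℕ × ℤ, c p.1 p.2 * e ((p.1 : ℂ) * τ + (p.2 : ℂ) * z)

theorem HasDerivAt.e_comp {f : ℂ → ℂ} {f' x : ℂ} (hf : HasDerivAt f f' x) :
    HasDerivAt (fun t => e (f t)) (2 * Real.pi * I * f' * e (f x)) x := by
  have h := (hf.const_mul (2 * (Real.pi : ℂ) * I)).cexp
  exact h.congr_deriv (by simp only [e]; ring)

theorem sigma1_eq (n : ℕ) : sigma1 n = ArithmeticFunction.sigma 1 n := by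
  simp [sigma1, ArithmeticFunction.sigma_one_apply]

theorem E2_coe (τ : UpperHalfPlane) : E2 τ = EisensteinSeries.E2 τ := by
  rw [EisensteinSeries.E2_eq_tsum_cexp,
    tsum_pnat_eq_tsum_succ (f := fun n : ℕ => (ArithmeticFunction.sigma 1 n : ℂ) *
      Complex.exp (2 * Real.pi * I * τ) ^ n), E2]
  congr 2
  refine tsum_congr fun n => ?_
  rw [sigma1_eq, e, ← Complex.exp_nat_mul]
  push_cast
  congr 2
  ring

/-- The lower row of a matrix in `SL₂(ℤ)` does not annihilate a point of the upper half-plane. -/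
theorem mul_add_ne_zero_of_det_eq_one {a b c d : ℤ} (hdet : a * d - b * c = 1) {τ : ℂ}
    (hτ : 0 < τ.im) : (c : ℂ) * τ + d ≠ 0 := by
  intro h
  have hc : c = 0 := by simpa [hτ.ne'] using congrArg Complex.im h
  have hd : d = 0 := by simpa [hc] using h
  simp [hc, hd] at hdet

theorem E2_moebius {a b c d : ℤ} (hdet : a * d - b * c = 1) {τ : ℂ} (hτ : 0 < τ.im) :
    E2 ((a * τ + b) / (c * τ + d)) =
      (c * τ + d) ^ 2 * E2 τ + 12 * c * (c * τ + d) / (2 * Real.pi * I) := by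
  let γ : Matrix.SpecialLinearGroup (Fin 2) ℤ :=
    ⟨!![a, b; c, d], by rw [Matrix.det_fin_two_of]; exact hdet⟩
  let t : UpperHalfPlane := ⟨τ, hτ⟩
  have hj := mul_add_ne_zero_of_det_eq_one hdet hτ
  have hden : UpperHalfPlane.denom γ t = c * τ + d := by
    rw [ModularGroup.denom_apply]
    simp [γ, t]
  have hcoe : ((γ • t : UpperHalfPlane) : ℂ) = (a * τ + b) / (c * τ + d) := by
    rw [UpperHalfPlane.specialLinearGroup_apply]
    simp [γ, t]
  have h := congrFun (EisensteinSeries.E2_slash_action γ) t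
  rw [ModularForm.SL_slash_apply, hden, ← E2_coe, hcoe] at h
  simp only [Pi.sub_apply, Pi.smul_apply, smul_eq_mul, EisensteinSeries.D2, hden, ← E2_coe,
    riemannZeta_two] at h
  have hγ : (γ 1 0 : ℂ) = c := by simp [γ]
  have ht : (t : ℂ) = τ := rfl
  rw [hγ, ht] at h
  have hpi : (Real.pi : ℂ) ≠ 0 := by exact_mod_cast Real.pi_ne_zero
  have hI := I_ne_zero
  rw [zpow_neg, ← div_eq_mul_inv, div_eq_iff (zpow_ne_zero _ hj)] at h
  rw [h, zpow_ofNat]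
  field_simp
  linear_combination (-12 * c) * I_sq

theorem Dt_of_hasDerivAt {φ : ℂ → ℂ → ℂ} {τ z φ' : ℂ}
    (h : HasDerivAt (fun t => φ t z) (2 * Real.pi * I * φ') τ) : Dt φ τ z = φ' := by
  rw [Dt, h.deriv, one_div, inv_mul_cancel_left₀ two_pi_I_ne_zero]

theorem Dz_of_hasDerivAt {φ : ℂ → ℂ → ℂ} {τ z φ' : ℂ}
    (h : HasDerivAt (fun w => φ τ w) (2 * Real.pi * I * φ') z) : Dz φ τ z = φ' := by
  rw [Dz, h.deriv, one_div, inv_mul_cancel_left₀ two_pi_I_ne_zero]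

theorem Dt_Qmon (n : ℕ) (r : ℤ) (τ z : ℂ) : Dt (Qmon n r) τ z = n * Qmon n r τ z := by
  refine Dt_of_hasDerivAt ?_
  have h := (((hasDerivAt_id τ).const_mul (n : ℂ)).add_const ((r : ℂ) * z)).e_comp
  exact h.congr_deriv (by simp only [Qmon, id]; ring)

theorem Dz_Qmon (n : ℕ) (r : ℤ) (τ z : ℂ) : Dz (Qmon n r) τ z = r * Qmon n r τ z := by
  refine Dz_of_hasDerivAt ?_
  have h := (((hasDerivAt_id z).const_mul (r : ℂ)).const_add ((n : ℂ) * τ)).e_comp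
  exact h.congr_deriv (by simp only [Qmon, id]; ring)

theorem Dz_Dz_Qmon (n : ℕ) (r : ℤ) (τ z : ℂ) :
    Dz (Dz (Qmon n r)) τ z = r ^ 2 * Qmon n r τ z := by
  refine Dz_of_hasDerivAt ?_
  simp only [Dz_Qmon]
  have h := (((hasDerivAt_id z).const_mul (r : ℂ)).const_add ((n : ℂ) * τ)).e_comp
  exact (h.const_mul (r : ℂ)).congr_deriv (by simp only [Qmon, id]; ring)

theorem Heat_Qmon (m n : ℕ) (r : ℤ) (τ z : ℂ) :
    Heat m (Qmon n r) τ z = (4 * m * n - r ^ 2) * Qmon n r τ z := by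
  rw [Heat, Dt_Qmon, Dz_Dz_Qmon]
  ring

theorem e_add (v w : ℂ) : e (v + w) = e v * e w := by
  simp only [e, mul_add, Complex.exp_add]

section Slash

variable (k m : ℤ) (n : ℕ) (r a b c d lam mu : ℤ)

/-- The phase `F` such that `(q^n ζ^r)|_{k,m} γ = (cτ + d)^{-k} e^{2πiF}`. -/
def slashPhase (τ z : ℂ) : ℂ :=
  m * (-c * (z + lam * τ + mu) ^ 2 / (c * τ + d) + lam ^ 2 * τ + 2 * lam * z) +
    (n * ((a * τ + b) / (c * τ + d)) + r * ((z + lam * τ + mu) / (c * τ + d)))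

theorem slash_Qmon (τ z : ℂ) :
    slash k m a b c d lam mu (Qmon n r) τ z =
      (c * τ + d) ^ (-k) * e (slashPhase m n r a b c d lam mu τ z) := by
  rw [slash, Qmon, slashPhase, mul_assoc, ← e_add]

theorem hasDerivAt_slashPhase_right (τ z : ℂ) :
    HasDerivAt (fun w => slashPhase m n r a b c d lam mu τ w)
      (m * (-2 * c * (z + lam * τ + mu) / (c * τ + d) + 2 * lam) + r / (c * τ + d)) z := by
  have hu : HasDerivAt (fun w : ℂ => w + lam * τ + mu) 1 z :=
    ((hasDerivAt_id z).add_const _).add_const _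
  have h := ((((((hu.pow 2).const_mul (-(c : ℂ))).div_const (c * τ + d)).add_const
    ((lam : ℂ) ^ 2 * τ)).add ((hasDerivAt_id z).const_mul (2 * (lam : ℂ)))).const_mul
      (m : ℂ)).add (((hu.div_const (c * τ + d)).const_mul (r : ℂ)).const_add
        ((n : ℂ) * ((a * τ + b) / (c * τ + d))))
  exact h.congr_deriv (by push_cast; ring)

variable {a b c d}

theorem hasDerivAt_slashPhase_left (hdet : a * d - b * c = 1) (τ z : ℂ)
    (hj : (c : ℂ) * τ + d ≠ 0) :
    HasDerivAt (fun t => slashPhase m n r a b c d lam mu t z)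
      (m * (-2 * c * lam * (z + lam * τ + mu) / (c * τ + d) +
          c ^ 2 * (z + lam * τ + mu) ^ 2 / (c * τ + d) ^ 2 + lam ^ 2) +
        n / (c * τ + d) ^ 2 +
        r * (lam / (c * τ + d) - c * (z + lam * τ + mu) / (c * τ + d) ^ 2)) τ := by
  have hdet' : (a : ℂ) * d - b * c = 1 := by exact_mod_cast hdet
  have affine (p q : ℂ) : HasDerivAt (fun t => p * t + q) p τ := by
    simpa using ((hasDerivAt_id τ).const_mul p).add_const q
  have hu : HasDerivAt (fun t : ℂ => z + lam * t + mu) lam τ := by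
    simpa using (((hasDerivAt_id τ).const_mul (lam : ℂ)).const_add z).add_const (mu : ℂ)
  have hl := affine ((lam : ℂ) ^ 2) 0
  simp only [add_zero] at hl
  have h := ((((((hu.pow 2).const_mul (-(c : ℂ))).div (affine c d) hj).add hl).add_const
    (2 * (lam : ℂ) * z)).const_mul (m : ℂ)).add
      ((((affine a b).div (affine c d) hj).const_mul (n : ℂ)).add
        ((hu.div (affine c d) hj).const_mul (r : ℂ)))
  refine h.congr_deriv ?_
  simp only [Pi.pow_apply]
  push_cast
  field_simp
  linear_combination (n : ℂ) * hdet'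

theorem Dt_slash_Qmon (hdet : a * d - b * c = 1) (τ z : ℂ) (hj : (c : ℂ) * τ + d ≠ 0) :
    Dt (slash k m a b c d lam mu (Qmon n r)) τ z =
      (m * (-2 * c * lam * (z + lam * τ + mu) / (c * τ + d) +
          c ^ 2 * (z + lam * τ + mu) ^ 2 / (c * τ + d) ^ 2 + lam ^ 2) +
        n / (c * τ + d) ^ 2 +
        r * (lam / (c * τ + d) - c * (z + lam * τ + mu) / (c * τ + d) ^ 2) -
        k * c / (2 * Real.pi * I * (c * τ + d))) *
      slash k m a b c d lam mu (Qmon n r) τ z := by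
  refine Dt_of_hasDerivAt ?_
  simp only [slash_Qmon]
  have hlin : HasDerivAt (fun t : ℂ => c * t + d) c τ := by
    simpa using ((hasDerivAt_id τ).const_mul (c : ℂ)).add_const (d : ℂ)
  have hpow : HasDerivAt (fun t : ℂ => (c * t + d) ^ (-k)) _ τ :=
    (hasDerivAt_zpow (-k) ((c : ℂ) * τ + d) (Or.inl hj)).comp (h := fun t : ℂ => c * t + d) τ hlin
  have h := hpow.mul (hasDerivAt_slashPhase_left m n r lam mu hdet τ z hj).e_comp
  refine h.congr_deriv ?_
  have hpi := two_pi_I_ne_zero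
  rw [zpow_sub_one₀ hj]
  generalize ((c : ℂ) * τ + d) ^ (-k) = A
  generalize e _ = B
  have hk : (2 * Real.pi * I) * (k * c / (2 * Real.pi * I * (c * τ + d))) =
      (k * c / (c * τ + d) : ℂ) := by
    rw [← div_div, mul_div_assoc', mul_div_cancel₀ _ hpi]
  push_cast
  linear_combination (A * B) * hk

theorem Dz_slash_Qmon (τ z : ℂ) :
    Dz (slash k m a b c d lam mu (Qmon n r)) τ z =
      (m * (-2 * c * (z + lam * τ + mu) / (c * τ + d) + 2 * lam) + r / (c * τ + d)) *
      slash k m a b c d lam mu (Qmon n r) τ z := by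
  refine Dz_of_hasDerivAt ?_
  simp only [slash_Qmon]
  have h := ((hasDerivAt_slashPhase_right m n r a b c d lam mu τ z).e_comp).const_mul
    (((c : ℂ) * τ + d) ^ (-k))
  exact h.congr_deriv (by ring)

theorem Dz_Dz_slash_Qmon (τ z : ℂ) :
    Dz (Dz (slash k m a b c d lam mu (Qmon n r))) τ z =
      ((m * (-2 * c * (z + lam * τ + mu) / (c * τ + d) + 2 * lam) + r / (c * τ + d)) ^ 2 -
        2 * m * c / (2 * Real.pi * I * (c * τ + d))) *
      slash k m a b c d lam mu (Qmon n r) τ z := by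
  refine Dz_of_hasDerivAt ?_
  simp only [Dz_slash_Qmon]
  simp only [slash_Qmon]
  have hu : HasDerivAt (fun w : ℂ => w + lam * τ + mu) 1 z :=
    ((hasDerivAt_id z).add_const _).add_const _
  have hfac := ((((hu.const_mul (-2 * (c : ℂ))).div_const (c * τ + d)).add_const
    (2 * (lam : ℂ))).const_mul (m : ℂ)).add_const ((r : ℂ) / (c * τ + d))
  have h := hfac.mul (((hasDerivAt_slashPhase_right m n r a b c d lam mu τ z).e_comp).const_mul
    (((c : ℂ) * τ + d) ^ (-k)))
  refine h.congr_deriv ?_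
  have hk : (2 * Real.pi * I) * (2 * m * c / (2 * Real.pi * I * (c * τ + d))) =
      (2 * m * c / (c * τ + d) : ℂ) := by
    rw [← div_div, mul_div_assoc', mul_div_cancel₀ _ two_pi_I_ne_zero]
  generalize ((c : ℂ) * τ + d) ^ (-k) = A
  generalize e _ = B
  linear_combination (A * B) * hk

theorem Heat_slash_Qmon (m : ℕ) (hdet : a * d - b * c = 1) (τ z : ℂ)
    (hj : (c : ℂ) * τ + d ≠ 0) :
    Heat m (slash k m a b c d lam mu (Qmon n r)) τ z =
      ((4 * m * n - r ^ 2) / (c * τ + d) ^ 2 -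
        2 * m * (2 * k - 1) * c / (2 * Real.pi * I * (c * τ + d))) *
      slash k m a b c d lam mu (Qmon n r) τ z := by
  rw [Heat, Dt_slash_Qmon k m n r lam mu hdet τ z hj, Dz_Dz_slash_Qmon]
  generalize slash k m a b c d lam mu (Qmon n r) τ z = S
  generalize (c : ℂ) * τ + d = j
  push_cast
  ring

end Slash

/-- `(L_m - (m(2k-1)/6)E₂)` commutes with the slash action on monomials. -/
theorem statement1 (k m n : ℕ) (hk : 0 < k) (hm : 0 < m) (hn : 0 < n) (r : ℤ)
    (a b c d lam mu : ℤ) (hdet : a * d - b * c = 1) (τ z : ℂ) (hτ : 0 < τ.im) :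
    HeatE k m (slash (k : ℤ) (m : ℤ) a b c d lam mu (Qmon n r)) τ z
      = slash ((k : ℤ) + 2) (m : ℤ) a b c d lam mu (HeatE k m (Qmon n r)) τ z := by
  have hj := mul_add_ne_zero_of_det_eq_one hdet hτ
  have hpi := two_pi_I_ne_zero
  have hslash : slash ((k : ℤ) + 2) (m : ℤ) a b c d lam mu (HeatE k m (Qmon n r)) τ z =
      ((4 * m * n - r ^ 2) - (m : ℂ) * (2 * k - 1) / 6 * E2 ((a * τ + b) / (c * τ + d))) /
        (c * τ + d) ^ 2 * slash k m a b c d lam mu (Qmon n r) τ z := by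
    rw [slash, slash, HeatE, Heat_Qmon, neg_add, zpow_add₀ hj, zpow_neg _ 2, zpow_ofNat]
    ring
  rw [hslash, HeatE, Heat_slash_Qmon k n r lam mu m hdet τ z hj, E2_moebius hdet hτ]
  generalize slash k m a b c d lam mu (Qmon n r) τ z = S
  push_cast
  generalize 2 * (Real.pi : ℂ) * I = p at hpi ⊢
  field_simp
  ring
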